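/- Let G = ℝ^{n+1} be a Grushin space of homogeneous dimension Q = n+2 with Q ≥ 4. Let 1 < p < Q and −Q(p−1) < β < Q − p. Then for every u ∈ C_0^∞(ℝ^{n+1}): ∫_{ℝ^{n+1}} |∂_ϱ u + ((Q−1)/ϱ) u|^p / ϱ^{β} dx dt ≥ ((Q(p−1)+β)/p)^p ∫_{ℝ^{n+1}} |u|^p / ϱ^{p+β} dx dt, and the constant ((Q(p−1)+β)/p)^p is best possible. -/

import Mathlib

open MeasureTheory Real

noncomputable section

/-- Points of the Grushin space `ℝ^{n+1}`. -/
abbrev GPt (n : ℕ) := EuclideanSpace ℝ (Fin n) × ℝ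

/-- Homogeneous Grushin norm `ϱ(x,t) = (|x|⁴ + 4t²)^{1/4}`. -/
def gNorm {n : ℕ} (z : GPt n) : ℝ := (‖z.1‖ ^ 4 + 4 * z.2 ^ 2) ^ ((1 : ℝ) / 4)

/-- The geometric term `ψ(x,t) = |x|²/ϱ²` (so that `|∇_G ϱ| = ψ^{1/2}`). -/
def gPsi {n : ℕ} (z : GPt n) : ℝ := ‖z.1‖ ^ 2 / gNorm z ^ 2

/-- Radial derivative `∂_ϱ u(x,t) = d/ds u(s·x/ϱ, s²·t/ϱ²)` at `s = ϱ(x,t)`. -/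
def radialDeriv {n : ℕ} (u : GPt n → ℝ) (z : GPt n) : ℝ :=
  deriv (fun s : ℝ => u ((s / gNorm z) • z.1, (s ^ 2 / gNorm z ^ 2) * z.2)) (gNorm z)

/-- The scaled function `u_R(x,t) = u(R·x/ϱ, R²·t/ϱ²)`. -/
def uScaled {n : ℕ} (R : ℝ) (u : GPt n → ℝ) (z : GPt n) : ℝ :=
  u ((R / gNorm z) • z.1, (R ^ 2 / gNorm z ^ 2) * z.2)

/-- Radial Grushin operator `L_{ϱ,G} u = ψ(∂_ϱ² u + ((Q−1)/ϱ) ∂_ϱ u)`. -/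
def radialLap {n : ℕ} (Q : ℝ) (u : GPt n → ℝ) (z : GPt n) : ℝ :=
  gPsi z * (radialDeriv (radialDeriv u) z + (Q - 1) / gNorm z * radialDeriv u z)

/-- The Grushin operator `L_G u = Δ_x u + |x|² ∂_t² u`. -/
def grushinOp {n : ℕ} (u : GPt n → ℝ) (z : GPt n) : ℝ :=
  (∑ i : Fin n,
      deriv (deriv fun s : ℝ => u (z.1 + s • EuclideanSpace.single i (1 : ℝ), z.2)) 0)
    + ‖z.1‖ ^ 2 * deriv (deriv fun s : ℝ => u (z.1, z.2 + s)) 0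

/-- The first-order operator `T_β(u) = ψ^{1/2}(∂_ϱ u + ((Q−β−2)/(2ϱ)) u)`. -/
def Tweight {n : ℕ} (Q β : ℝ) (u : GPt n → ℝ) (z : GPt n) : ℝ :=
  Real.sqrt (gPsi z) * (radialDeriv u z + (Q - β - 2) / (2 * gNorm z) * u z)

/-- The iterated operator `R_{β,k} = T_β ∘ T_{β+2} ∘ ⋯ ∘ T_{β+2k}`. -/
def Rop {n : ℕ} (Q : ℝ) : ℕ → ℝ → (GPt n → ℝ) → GPt n → ℝ
  | 0, β, u => Tweight Q β u
  | k + 1, β, u => Tweight Q β (Rop Q k (β + 2) u)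

/-- The constants `Λ_k(Q,p,β)`. -/
def Lam (Q p β : ℝ) (k : ℕ) : ℝ :=
  if k = 1 then ((Q - p - β) / p) ^ p
  else ((Q * (p - 1) + β + ((k : ℝ) - 2) * p) * (Q - β - (k : ℝ) * p) / p ^ 2) ^ p

/-- The constant `C_{2l,p,β} = ∏_{i=1}^{l} Λ_{2i}(Q,p,β)`. -/
def Ceven (Q p β : ℝ) (l : ℕ) : ℝ := ∏ i ∈ Finset.range l, Lam Q p β (2 * i + 2)

/-- The constant `C_{2l+1,p,β} = ∏_{i=0}^{l} Λ_{2i+1}(Q,p,β)`. -/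
def Codd (Q p β : ℝ) (l : ℕ) : ℝ := ∏ i ∈ Finset.range (l + 1), Lam Q p β (2 * i + 1)

/-- The constant `A_m = ((Q+m)² + (Q−4−m)²)/4`. -/
def Aconst (Q m : ℝ) : ℝ := ((Q + m) ^ 2 + (Q - 4 - m) ^ 2) / 4

/-- The constants `D_{j,m,β}` given by the iteration
`D_{j,m+1,β} = Λ_{2m+2}(Q,2,β) D_{j−2,m,β} + A_{β+4m} D_{j−1,m,β} + D_{j,m,β}`,
with `D_{0,0,β} = 1` (and vanishing off-range values). -/
def Dconst (Q β : ℝ) : ℕ → ℤ → ℝ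
  | 0, j => if j = 0 then 1 else 0
  | m + 1, j =>
      Lam Q 2 β (2 * m + 2) * Dconst Q β m (j - 2)
        + Aconst Q (β + 4 * (m : ℝ)) * Dconst Q β m (j - 1) + Dconst Q β m j

/-- The constants `B_{j,m,β,k}` given by the iteration
`B_{j,m+1,β,k} = Λ_2(Q,2,β+2k+2) B_{j−2,m,β+4,k} + A_{β+2k+2} B_{j−1,m,β+2,k+1} + B_{j,m,β,k+2}`,
with `B_{0,0,β,k} = 1` (and vanishing off-range values). -/
def Bconst (Q : ℝ) : ℕ → ℤ → ℝ → ℝ → ℝ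
  | 0, j, _, _ => if j = 0 then 1 else 0
  | m + 1, j, β, k =>
      Lam Q 2 (β + 2 * k + 2) 2 * Bconst Q m (j - 2) (β + 4) k
        + Aconst Q (β + 2 * k + 2) * Bconst Q m (j - 1) (β + 2) (k + 1)
        + Bconst Q m j β (k + 2)

/-- Surface measure `ω_n` of the unit sphere in `ℝ^n`. -/
def sphSurface (n : ℕ) : ℝ :=
  n * (volume (Metric.ball (0 : EuclideanSpace ℝ (Fin n)) 1)).toReal

/-- The integral constant `C^{Ω,m} = ω_n ∫_0^π (sin φ)^{(n+m)/2} dφ`. -/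
def COmega (n m : ℕ) : ℝ :=
  sphSurface n * ∫ φ in (0 : ℝ)..π, Real.sin φ ^ (((n : ℝ) + (m : ℝ)) / 2)

/-- The sharp Frank–Seiringer constant `c_p = min_{0<t≤1/2} [(1−t)^p − t^p + p t^{p−1}]`. -/
def cFS (p : ℝ) : ℝ :=
  sInf {y : ℝ | ∃ t : ℝ, 0 < t ∧ t ≤ 1 / 2 ∧ y = (1 - t) ^ p - t ^ p + p * t ^ (p - 1)}

/-- Compactly supported smooth test functions with (closed) support inside `s`. -/
def IsTest {n : ℕ} (s : Set (GPt n)) (u : GPt n → ℝ) : Prop :=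
  ContDiff ℝ (⊤ : ℕ∞) u ∧ HasCompactSupport u ∧ tsupport u ⊆ s

/-- A function on the Grushin space is radial if it depends only on the homogeneous norm. -/
def IsRadial {n : ℕ} (u : GPt n → ℝ) : Prop :=
  ∃ f : ℝ → ℝ, ∀ z, u z = f (gNorm z)

/-- The distance function `d_H(u,R)`. -/
def dH {n : ℕ} (Q p β R : ℝ) (u : GPt n → ℝ) : ℝ :=
  (∫ z : GPt n,
      |u z - R ^ ((Q - p - β) / p) * uScaled R u z * gNorm z ^ (-((Q - p - β) / p))| ^ p *
        gPsi z ^ (p / 2) / (|Real.log (R / gNorm z)| ^ p * gNorm z ^ (p + β))) ^ (1 / p)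

/-- The distance function `d_R(u,k,β)`. -/
def dRdist {n : ℕ} (Q p β R : ℝ) (k : ℕ) (u : GPt n → ℝ) : ℝ :=
  (∫ z : GPt n,
      (|u z| ^ ((p - 2) / 2) * u z -
          |uScaled R u z| ^ ((p - 2) / 2) * uScaled R u z *
            (gNorm z / R) ^ (-((Q - (k : ℝ) * p - β) / 2))) ^ 2 *
        gPsi z ^ (p / 2) /
        (gNorm z ^ ((k : ℝ) * p + β) * Real.log (R / gNorm z) ^ 2)) ^ ((1 : ℝ) / 2)

/-- The distance function `d_C(u,R)`. -/
def dCdist {n : ℕ} (Q p R : ℝ) (u : GPt n → ℝ) : ℝ :=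
  (∫ z in {z : GPt n | gNorm z < 1},
      |u z - Real.log (1 / gNorm z) ^ ((p - 1) / p) * R ^ ((p - 1) / p) *
          uScaled (Real.exp (-1 / R)) u z| ^ p *
        gPsi z ^ (p / 2) /
        (gNorm z ^ Q * Real.log (1 / gNorm z) ^ p *
          |Real.log (R * Real.log (1 / gNorm z))| ^ p)) ^ (1 / p)

variable {n : ℕ}

/-- The anisotropic dilation `δ_r(x,t) = (r x, r² t)`. -/
def gDil (r : ℝ) (z : GPt n) : GPt n := (r • z.1, r ^ 2 * z.2)

theorem gNorm_nonneg (z : GPt n) : 0 ≤ gNorm z := by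
  unfold gNorm; positivity

theorem gNorm_pow_four (z : GPt n) : gNorm z ^ 4 = ‖z.1‖ ^ 4 + 4 * z.2 ^ 2 := by
  unfold gNorm
  rw [← Real.rpow_natCast, ← Real.rpow_mul (by positivity)]
  norm_num

theorem gNorm_gDil {r : ℝ} (hr : 0 ≤ r) (z : GPt n) : gNorm (gDil r z) = r * gNorm z := by
  refine (pow_left_inj₀ (gNorm_nonneg _) (mul_nonneg hr (gNorm_nonneg _)) four_ne_zero).1 ?_
  rw [gNorm_pow_four, mul_pow, gNorm_pow_four]
  simp only [gDil, norm_smul, Real.norm_eq_abs, abs_of_nonneg hr]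
  ring

theorem gNorm_zero : gNorm (0 : GPt n) = 0 := by
  simp [gNorm]

theorem gNorm_eq_zero {z : GPt n} : gNorm z = 0 ↔ z = 0 := by
  refine ⟨fun h => ?_, fun h => h ▸ gNorm_zero⟩
  have h4 := gNorm_pow_four z
  rw [h] at h4
  have h1 : ‖z.1‖ ^ 4 = 0 := by nlinarith [sq_nonneg z.2, pow_nonneg (norm_nonneg z.1) 4]
  have h2 : z.2 ^ 2 = 0 := by nlinarith [sq_nonneg z.2, pow_nonneg (norm_nonneg z.1) 4]
  exact Prod.ext (by simpa using h1) (by simpa using h2)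

theorem gNorm_pos {z : GPt n} (hz : z ≠ 0) : 0 < gNorm z :=
  (gNorm_nonneg z).lt_of_ne fun h => hz (gNorm_eq_zero.1 h.symm)

theorem continuous_gNorm : Continuous (gNorm : GPt n → ℝ) := by
  unfold gNorm
  exact Continuous.rpow_const (by fun_prop) fun _ => Or.inr (by norm_num)

theorem isCompact_gNorm_le (R : ℝ) : IsCompact {z : GPt n | gNorm z ≤ R} := by
  refine ((isCompact_closedBall (0 : EuclideanSpace ℝ (Fin n)) R).prod
    (isCompact_closedBall (0 : ℝ) (R ^ 2))).of_isClosed_subset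
    (isClosed_le continuous_gNorm continuous_const) fun z (hz : gNorm z ≤ R) => ?_
  have h0 := gNorm_nonneg z
  have h4 := gNorm_pow_four z
  have hR : gNorm z ^ 4 ≤ R ^ 4 := by gcongr
  have hR0 : 0 ≤ R := h0.trans hz
  simp only [Set.mem_prod, mem_closedBall_zero_iff]
  constructor
  · refine (pow_le_pow_iff_left₀ (norm_nonneg _) hR0 four_ne_zero).1 ?_
    nlinarith [sq_nonneg z.2]
  · rw [Real.norm_eq_abs]
    refine abs_le_of_sq_le_sq ?_ (by positivity)
    nlinarith [sq_nonneg z.2, pow_nonneg (norm_nonneg z.1) 4]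

theorem continuous_gDil (r : ℝ) : Continuous (gDil r : GPt n → GPt n) := by
  unfold gDil; fun_prop

theorem map_gDil_volume {r : ℝ} (hr : 0 < r) :
    Measure.map (gDil r : GPt n → GPt n) volume
      = ENNReal.ofReal ((r ^ (n + 2))⁻¹) • (volume : Measure (GPt n)) := by
  have h1 := Measure.map_addHaar_smul (volume : Measure (EuclideanSpace ℝ (Fin n))) hr.ne'
  have h2 := Measure.map_addHaar_smul (volume : Measure ℝ) (pow_pos hr 2).ne'
  have h3 : (gDil r : GPt n → GPt n) = Prod.map (r • ·) ((r ^ 2) • ·) := by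
    ext z <;> simp [gDil]
  rw [h3, Measure.volume_eq_prod, ← Measure.map_prod_map _ _ (by fun_prop) (by fun_prop), h1, h2,
    Measure.prod_smul_left, Measure.prod_smul_right, smul_smul,
    ← ENNReal.ofReal_mul (abs_nonneg _), ← abs_mul, finrank_euclideanSpace_fin,
    Module.finrank_self, pow_one, ← mul_inv, ← pow_add, abs_of_pos (by positivity)]

theorem lintegral_comp_gDil {r : ℝ} (hr : 0 < r) {F : GPt n → ENNReal} (hF : Measurable F) :
    ∫⁻ z, F (gDil r z) = ENNReal.ofReal ((r ^ (n + 2))⁻¹) * ∫⁻ z, F z := by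
  rw [← lintegral_map hF (continuous_gDil r).measurable, map_gDil_volume hr,
    lintegral_smul_measure, smul_eq_mul]

theorem volume_gNorm_le {r : ℝ} (hr : 0 < r) :
    volume {z : GPt n | gNorm z ≤ r}
      = ENNReal.ofReal (r ^ (n + 2)) * volume {z : GPt n | gNorm z ≤ 1} := by
  have hm : MeasurableSet {z : GPt n | gNorm z ≤ 1} :=
    (isClosed_le continuous_gNorm continuous_const).measurableSet
  have h := Measure.map_apply (μ := volume) (continuous_gDil (n := n) r⁻¹).measurable hm
  rw [map_gDil_volume (inv_pos.2 hr), Measure.smul_apply, smul_eq_mul, inv_pow, inv_inv] at h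
  rw [h]
  congr 1
  ext z
  simp only [Set.mem_ofPred_eq, Set.mem_preimage, gNorm_gDil (inv_pos.2 hr).le]
  rw [inv_mul_le_iff₀ hr, mul_one]

theorem volume_gNorm_le_one_pos : 0 < (volume {z : GPt n | gNorm z ≤ 1}).toReal := by
  refine ENNReal.toReal_pos ?_ (isCompact_gNorm_le 1).measure_lt_top.ne
  have ho : IsOpen {z : GPt n | gNorm z < 1} := isOpen_lt continuous_gNorm continuous_const
  have : 0 < volume {z : GPt n | gNorm z < 1} :=
    ho.measure_pos volume ⟨0, by simp [gNorm_zero]⟩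
  exact (this.trans_le (measure_mono fun z (hz : gNorm z < 1) => hz.le)).ne'

theorem ae_ne_zero_GPt : ∀ᵐ z : GPt n, z ≠ 0 := by
  rw [Measure.volume_eq_prod]
  exact Measure.ae_ne _ _

theorem volume_log_gNorm_Ioc {a b : ℝ} (hab : a < b) :
    volume ((fun z : GPt n => Real.log (gNorm z)) ⁻¹' Set.Ioc a b)
      = ENNReal.ofReal ((volume {z : GPt n | gNorm z ≤ 1}).toReal
          * (Real.exp ((n + 2) * b) - Real.exp ((n + 2) * a))) := by
  have hae : ((fun z : GPt n => Real.log (gNorm z)) ⁻¹' Set.Ioc a b : Set (GPt n)) =ᵐ[volume]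
      ({z : GPt n | gNorm z ≤ Real.exp b} \ {z : GPt n | gNorm z ≤ Real.exp a} : Set (GPt n)) := by
    filter_upwards [ae_ne_zero_GPt] with z hz
    have hp := gNorm_pos hz
    refine propext ?_
    change Real.log (gNorm z) ∈ Set.Ioc a b ↔ gNorm z ≤ Real.exp b ∧ ¬ gNorm z ≤ Real.exp a
    rw [Set.mem_Ioc, Real.log_le_iff_le_exp hp, Real.lt_log_iff_exp_lt hp, not_le, and_comm]
  have hf : volume {z : GPt n | gNorm z ≤ 1} ≠ ⊤ := (isCompact_gNorm_le 1).measure_lt_top.ne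
  have hsub : {z : GPt n | gNorm z ≤ Real.exp a} ⊆ {z : GPt n | gNorm z ≤ Real.exp b} :=
    fun z (hz : gNorm z ≤ Real.exp a) => hz.trans (Real.exp_le_exp.2 hab.le)
  rw [measure_congr hae, measure_sdiff hsub
      (isClosed_le continuous_gNorm continuous_const).measurableSet.nullMeasurableSet
      (isCompact_gNorm_le _).measure_lt_top.ne,
    volume_gNorm_le (Real.exp_pos _), volume_gNorm_le (Real.exp_pos _),
    ← ENNReal.ofReal_toReal hf, ENNReal.toReal_ofReal ENNReal.toReal_nonneg,
    ← ENNReal.ofReal_mul (by positivity), ← ENNReal.ofReal_mul (by positivity),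
    ← ENNReal.ofReal_sub _ (by positivity), ← Real.exp_nat_mul, ← Real.exp_nat_mul]
  push_cast
  ring_nf

/-- Polar coordinates for the homogeneous norm, in logarithmic form. -/
theorem map_log_gNorm :
    Measure.map (fun z : GPt n => Real.log (gNorm z)) volume
      = (volume : Measure ℝ).withDensity fun s =>
          ENNReal.ofReal ((volume {z : GPt n | gNorm z ≤ 1}).toReal * (n + 2)
            * Real.exp ((n + 2) * s)) := by
  have hm : Measurable fun z : GPt n => Real.log (gNorm z) :=
    Real.measurable_log.comp continuous_gNorm.measurable
  refine Measure.ext_of_Ioc' _ _ (fun a b hab => ?_) fun a b hab => ?_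
  · rw [Measure.map_apply hm measurableSet_Ioc, volume_log_gNorm_Ioc hab]
    exact ENNReal.ofReal_ne_top
  · rw [Measure.map_apply hm measurableSet_Ioc, volume_log_gNorm_Ioc hab,
      withDensity_apply _ measurableSet_Ioc, ← ofReal_integral_eq_lintegral_ofReal,
      ← intervalIntegral.integral_of_le hab.le]
    · congr 1
      rw [intervalIntegral.integral_eq_sub_of_hasDerivAt
        (f := fun s => (volume {z : GPt n | gNorm z ≤ 1}).toReal * Real.exp ((n + 2) * s))]
      · ring
      · intro s _
        have := (((hasDerivAt_id s).const_mul ((n : ℝ) + 2)).exp).const_mul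
          (volume {z : GPt n | gNorm z ≤ 1}).toReal
        refine this.congr_deriv ?_
        simp only [id]
        ring
      · exact Continuous.intervalIntegrable (by fun_prop) _ _
    · exact (Continuous.integrableOn_Icc (by fun_prop)).mono_set Set.Ioc_subset_Icc_self
    · exact Filter.Eventually.of_forall fun s => by positivity

theorem lintegral_rpow_Ioc_zero_one {c : ℝ} (hc : 0 < c) :
    ∫⁻ r in Set.Ioc (0 : ℝ) 1, ENNReal.ofReal (r ^ (c - 1)) = ENNReal.ofReal c⁻¹ := by
  rw [← ofReal_integral_eq_lintegral_ofReal, ← intervalIntegral.integral_of_le zero_le_one,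
    integral_rpow (Or.inl (by linarith))]
  · simp [hc.ne']
  · exact (intervalIntegrable_iff_integrableOn_Ioc_of_le zero_le_one).1
      (intervalIntegral.intervalIntegrable_rpow' (by linarith))
  · exact (ae_restrict_mem measurableSet_Ioc).mono fun r hr => Real.rpow_nonneg hr.1.le _

theorem lintegral_Ioc_rpow_le {p c m : ℝ} (hp : 1 < p) (hc : 0 < c) {h : ℝ → ℝ}
    (hh : Measurable h) :
    (∫⁻ r in Set.Ioc (0 : ℝ) 1, ENNReal.ofReal (r ^ m * |h r|)) ^ p
      ≤ ENNReal.ofReal (c⁻¹ ^ (p - 1)) * ∫⁻ r in Set.Ioc (0 : ℝ) 1,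
          ENNReal.ofReal (r ^ (m * p - (c - 1) * (p - 1)) * |h r| ^ p) := by
  have hp0 : 0 < p := by linarith
  have hp1 : 0 < p - 1 := by linarith
  have hpq : (p / (p - 1)).HolderConjugate p :=
    (Real.HolderConjugate.conjExponent hp).symm
  have key := ENNReal.lintegral_mul_le_Lp_mul_Lq (volume.restrict (Set.Ioc (0 : ℝ) 1)) hpq
    (f := fun r => ENNReal.ofReal (r ^ ((c - 1) * ((p - 1) / p))))
    (g := fun r => ENNReal.ofReal (r ^ (m - (c - 1) * ((p - 1) / p)) * |h r|))
    (by fun_prop) (by fun_prop)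
  have e1 : ∫⁻ r in Set.Ioc (0 : ℝ) 1, ENNReal.ofReal (r ^ m * |h r|)
      = ∫⁻ r in Set.Ioc (0 : ℝ) 1,
        ((fun r => ENNReal.ofReal (r ^ ((c - 1) * ((p - 1) / p)))) *
          fun r => ENNReal.ofReal (r ^ (m - (c - 1) * ((p - 1) / p)) * |h r|)) r := by
    refine setLIntegral_congr_fun measurableSet_Ioc fun r hr => ?_
    have hr0 : 0 < r := hr.1
    rw [Pi.mul_apply, ← ENNReal.ofReal_mul (by positivity), ← mul_assoc, ← Real.rpow_add hr0]
    congr 3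
    ring
  have e2 : ∫⁻ r in Set.Ioc (0 : ℝ) 1,
      ENNReal.ofReal (r ^ ((c - 1) * ((p - 1) / p))) ^ (p / (p - 1)) = ENNReal.ofReal c⁻¹ := by
    rw [← lintegral_rpow_Ioc_zero_one hc]
    refine setLIntegral_congr_fun measurableSet_Ioc fun r hr => ?_
    have hr0 : 0 < r := hr.1
    rw [ENNReal.ofReal_rpow_of_nonneg (by positivity) (by positivity), ← Real.rpow_mul hr0.le]
    congr 2
    field_simp
  have e3 : ∫⁻ r in Set.Ioc (0 : ℝ) 1,
      ENNReal.ofReal (r ^ (m - (c - 1) * ((p - 1) / p)) * |h r|) ^ p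
      = ∫⁻ r in Set.Ioc (0 : ℝ) 1,
          ENNReal.ofReal (r ^ (m * p - (c - 1) * (p - 1)) * |h r| ^ p) := by
    refine setLIntegral_congr_fun measurableSet_Ioc fun r hr => ?_
    have hr0 : 0 < r := hr.1
    rw [ENNReal.ofReal_rpow_of_nonneg (by positivity) (by positivity),
      Real.mul_rpow (by positivity) (abs_nonneg _), ← Real.rpow_mul hr0.le]
    congr 3
    field_simp
  rw [e2, e3, ← e1] at key
  refine (ENNReal.rpow_le_rpow key hp0.le).trans_eq ?_
  rw [ENNReal.mul_rpow_of_nonneg _ _ hp0.le, ← ENNReal.rpow_mul, ← ENNReal.rpow_mul,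
    one_div_mul_cancel hp0.ne', ENNReal.rpow_one, ENNReal.ofReal_rpow_of_pos (by positivity)]
  congr 3
  field_simp

/-- Hardy-type inequality for functions dominated by an average over dilations. -/
theorem lintegral_le_of_dilation_average {p β c : ℝ} (hp : 1 < p) (hc : 0 < c)
    (hcp : c * p = (n + 2) * (p - 1) + β) {u g : GPt n → ℝ} (hg : Measurable g)
    (hug : ∀ z, ENNReal.ofReal |u z|
      ≤ ∫⁻ r in Set.Ioc (0 : ℝ) 1, ENNReal.ofReal (r ^ (n : ℝ) * |g (gDil r z)|)) :
    ∫⁻ z, ENNReal.ofReal (|u z| ^ p * gNorm z ^ (-(p + β)))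
      ≤ ENNReal.ofReal (c⁻¹ ^ p) *
        ∫⁻ z, ENNReal.ofReal (|g z| ^ p * gNorm z ^ (-(p + β))) := by
  have hp0 : 0 < p := by linarith
  have hd : Measurable fun q : GPt n × ℝ => gDil q.2 q.1 := by
    unfold gDil
    exact Continuous.measurable (by fun_prop)
  have hρ : Measurable (gNorm : GPt n → ℝ) := continuous_gNorm.measurable
  set F : GPt n → ENNReal := fun z => ENNReal.ofReal (|g z| ^ p * gNorm z ^ (-(p + β))) with hF
  have hFm : Measurable F := by
    rw [hF]; fun_prop
  set e : ℝ := n * p - (c - 1) * (p - 1) + (p + β) with he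
  have hpt : ∀ z : GPt n, ENNReal.ofReal (|u z| ^ p * gNorm z ^ (-(p + β)))
      ≤ ENNReal.ofReal (c⁻¹ ^ (p - 1)) * ∫⁻ r in Set.Ioc (0 : ℝ) 1,
        ENNReal.ofReal (r ^ e) * F (gDil r z) := by
    intro z
    have h1 := (ENNReal.rpow_le_rpow (hug z) hp0.le).trans
      (lintegral_Ioc_rpow_le (m := n) hp hc (h := fun r => g (gDil r z))
        (hg.comp (hd.comp (by fun_prop : Measurable fun r : ℝ => (z, r)))))
    rw [ENNReal.ofReal_rpow_of_nonneg (abs_nonneg _) hp0.le] at h1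
    rw [ENNReal.ofReal_mul (by positivity)]
    refine (mul_le_mul_left h1 _).trans_eq ?_
    rw [mul_assoc, ← lintegral_mul_const' _ _ ENNReal.ofReal_ne_top]
    congr 1
    refine setLIntegral_congr_fun measurableSet_Ioc fun r hr => ?_
    have hr0 : 0 < r := hr.1
    have hn := gNorm_nonneg z
    simp only [hF]
    rw [← ENNReal.ofReal_mul (by positivity), ← ENNReal.ofReal_mul (by positivity),
      gNorm_gDil hr0.le, Real.mul_rpow hr0.le hn, he, Real.rpow_add hr0 _ (p + β),
      Real.rpow_neg hr0.le]
    congr 1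
    field_simp
  refine (lintegral_mono hpt).trans_eq ?_
  rw [lintegral_const_mul' _ _ ENNReal.ofReal_ne_top, lintegral_lintegral_swap]
  · have h2 : ∀ r ∈ Set.Ioc (0 : ℝ) 1, ∫⁻ z : GPt n, ENNReal.ofReal (r ^ e) * F (gDil r z)
        = ENNReal.ofReal (r ^ (c - 1)) * ∫⁻ z, F z := by
      intro r hr
      have hr0 : 0 < r := hr.1
      rw [lintegral_const_mul' _ _ ENNReal.ofReal_ne_top, lintegral_comp_gDil hr0 hFm, ← mul_assoc,
        ← ENNReal.ofReal_mul (by positivity), ← Real.rpow_natCast, ← Real.rpow_neg hr0.le,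
        ← Real.rpow_add hr0]
      congr 3
      rw [he]
      push_cast
      linarith
    rw [setLIntegral_congr_fun measurableSet_Ioc h2, lintegral_mul_const _ (by fun_prop),
      lintegral_rpow_Ioc_zero_one hc, ← mul_assoc, ← ENNReal.ofReal_mul (by positivity)]
    congr 2
    nth_rewrite 2 [← Real.rpow_one c⁻¹]
    rw [← Real.rpow_add (by positivity)]
    congr 1
    ring
  · refine Measurable.aemeasurable ?_
    exact (by fun_prop : Measurable fun q : GPt n × ℝ => ENNReal.ofReal (q.2 ^ e)).mul
      (hFm.comp hd)

/-- The generator of the dilations plus `Q - 1`: `ϱ ∂_ϱ u + (Q - 1) u`. -/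
def gEuler (u : GPt n → ℝ) (z : GPt n) : ℝ := fderiv ℝ u z (z.1, 2 * z.2) + (n + 1) * u z

theorem hasDerivAt_gDil {u : GPt n → ℝ} (hu : Differentiable ℝ u) (z : GPt n) (r : ℝ) :
    HasDerivAt (fun r => u (gDil r z)) (fderiv ℝ u (gDil r z) (z.1, 2 * r * z.2)) r := by
  refine (hu (gDil r z)).hasFDerivAt.comp_hasDerivAt r ?_
  have h1 : HasDerivAt (fun r : ℝ => r • z.1) z.1 r := by
    simpa using (hasDerivAt_id r).smul_const z.1
  have h2 : HasDerivAt (fun r : ℝ => r ^ 2 * z.2) (2 * r * z.2) r := by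
    simpa using (hasDerivAt_pow 2 r).mul_const z.2
  exact h1.prodMk h2

theorem fderiv_gDil_mul {u : GPt n → ℝ} (z : GPt n) (r : ℝ) :
    r * fderiv ℝ u (gDil r z) (z.1, 2 * r * z.2) + (n + 1) * u (gDil r z)
      = gEuler u (gDil r z) := by
  rw [gEuler, ← smul_eq_mul r, ← map_smul]
  congr 2
  ext <;> simp [gDil]
  ring

theorem radialDeriv_add {u : GPt n → ℝ} (hu : Differentiable ℝ u) (z : GPt n) :
    radialDeriv u z + ((n : ℝ) + 2 - 1) / gNorm z * u z = gEuler u z / gNorm z := by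
  rcases eq_or_ne z 0 with rfl | hz
  · simp [radialDeriv, gNorm_zero]
  have hp := gNorm_pos hz
  have h1 : gDil 1 z = z := by simp [gDil]
  have h := hasDerivAt_gDil hu z 1
  have h2 := h.comp_of_eq (gNorm z) ((hasDerivAt_id (gNorm z)).div_const (gNorm z))
    (div_self hp.ne').symm
  have h3 : radialDeriv u z = fderiv ℝ u z (z.1, 2 * z.2) * (1 / gNorm z) := by
    rw [h1, mul_one] at h2
    rw [← h2.deriv, radialDeriv]
    congr 1
    funext s
    simp [gDil, div_pow]
  rw [h3, gEuler]
  ring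

theorem continuous_gEuler {u : GPt n → ℝ} (hu : ContDiff ℝ (⊤ : ℕ∞) u) :
    Continuous (gEuler u) := by
  unfold gEuler
  have h1 : Continuous (fderiv ℝ u) := hu.continuous_fderiv (by simp)
  have h2 := hu.continuous
  exact (h1.clm_apply (by fun_prop)).add (by fun_prop)

theorem gEuler_eq_zero {u : GPt n → ℝ} {z : GPt n} (hz : z ∉ tsupport u) : gEuler u z = 0 := by
  have h1 : fderiv ℝ u z = 0 := by
    by_contra h
    exact hz (support_fderiv_subset ℝ h)
  rw [gEuler, h1, image_eq_zero_of_notMem_tsupport hz]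
  simp

theorem eq_integral_gEuler {u : GPt n → ℝ} (hu : ContDiff ℝ (⊤ : ℕ∞) u) (z : GPt n) :
    u z = ∫ r in (0 : ℝ)..1, r ^ n * gEuler u (gDil r z) := by
  have hd := hu.differentiable (by simp)
  have hc := continuous_gEuler hu
  rw [intervalIntegral.integral_eq_sub_of_hasDerivAt (f := fun r => r ^ (n + 1) * u (gDil r z))]
  · simp [gDil]
  · intro r _
    refine ((hasDerivAt_pow (n + 1) r).mul (hasDerivAt_gDil hd z r)).congr_deriv ?_
    rw [← fderiv_gDil_mul]
    push_cast
    ring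
  · refine Continuous.intervalIntegrable ?_ _ _
    have : Continuous fun r : ℝ => gDil r z := by unfold gDil; fun_prop
    fun_prop

theorem ofReal_abs_le_lintegral_gEuler {u : GPt n → ℝ} (hu : ContDiff ℝ (⊤ : ℕ∞) u) (z : GPt n) :
    ENNReal.ofReal |u z|
      ≤ ∫⁻ r in Set.Ioc (0 : ℝ) 1, ENNReal.ofReal (r ^ (n : ℝ) * |gEuler u (gDil r z)|) := by
  rw [eq_integral_gEuler hu z, intervalIntegral.integral_of_le zero_le_one,
    ← Real.enorm_eq_ofReal_abs]
  refine (enorm_integral_le_lintegral_enorm _).trans_eq ?_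
  refine setLIntegral_congr_fun measurableSet_Ioc fun r hr => ?_
  have hr0 : 0 < r := hr.1
  simp only [Real.enorm_eq_ofReal_abs, abs_mul, Real.rpow_natCast, abs_of_pos (pow_pos hr0 n)]

/-- Negative powers of the homogeneous norm above `-Q` are locally integrable. -/
theorem integrableOn_gNorm_rpow {a : ℝ} (ha : a < n + 2) (R : ℝ) :
    IntegrableOn (fun z : GPt n => gNorm z ^ (-a)) {z | Real.log (gNorm z) ≤ R} := by
  have hm : Measurable fun z : GPt n => Real.log (gNorm z) :=
    Real.measurable_log.comp continuous_gNorm.measurable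
  have hae : (fun z : GPt n => Real.exp (-a * Real.log (gNorm z))) =ᵐ[volume]
      fun z : GPt n => gNorm z ^ (-a) := by
    filter_upwards [ae_ne_zero_GPt] with z hz
    rw [Real.rpow_def_of_pos (gNorm_pos hz), mul_comm]
  refine IntegrableOn.congr_fun_ae ?_ (ae_restrict_of_ae hae)
  have h1 : IntegrableOn (fun s : ℝ => Real.exp (-a * s)) (Set.Iic R)
      (Measure.map (fun z : GPt n => Real.log (gNorm z)) volume) := by
    rw [map_log_gNorm, IntegrableOn, restrict_withDensity measurableSet_Iic,
      integrable_withDensity_iff (by fun_prop) (by simp)]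
    refine ((integrableOn_exp_mul_Iic (sub_pos.2 ha) R).const_mul
      ((volume {z : GPt n | gNorm z ≤ 1}).toReal * (n + 2))).congr ?_
    refine Filter.Eventually.of_forall fun s => ?_
    beta_reduce
    rw [ENNReal.toReal_ofReal (by positivity), mul_left_comm, ← Real.exp_add]
    congr 2
    ring
  rw [IntegrableOn, Measure.restrict_map hm measurableSet_Iic] at h1
  exact h1.comp_measurable hm

theorem integrable_abs_rpow_mul_gNorm_rpow {p a : ℝ} (hp : 0 < p) (ha : a < n + 2)
    {f : GPt n → ℝ} (hf : Continuous f) {K : Set (GPt n)} (hK : IsCompact K)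
    (hfK : ∀ z ∉ K, f z = 0) :
    Integrable fun z => |f z| ^ p * gNorm z ^ (-a) := by
  obtain ⟨R, hR⟩ := hK.exists_bound_of_continuousOn continuous_gNorm.continuousOn
  obtain ⟨C, hC⟩ := hK.exists_bound_of_continuousOn hf.continuousOn
  have hsupp : Function.support (fun z => |f z| ^ p * gNorm z ^ (-a))
      ⊆ {z : GPt n | Real.log (gNorm z) ≤ R} := by
    intro z hz
    have hzK : z ∈ K := by
      by_contra h
      exact hz (by simp [hfK z h, hp.ne'])
    exact (Real.log_le_self (gNorm_nonneg z)).trans ((le_abs_self _).trans (hR z hzK))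
  rw [← integrableOn_iff_integrable_of_support_subset hsupp]
  refine (integrableOn_gNorm_rpow ha R).bdd_mul (c := |C| ^ p) ?_ ?_
  · exact (hf.abs.rpow_const fun _ => Or.inr hp.le).aestronglyMeasurable
  · refine Filter.Eventually.of_forall fun z => ?_
    rw [Real.norm_eq_abs, abs_of_nonneg (by positivity)]
    refine Real.rpow_le_rpow (abs_nonneg _) ?_ hp.le
    by_cases hz : z ∈ K
    · exact (hC z hz).trans (le_abs_self C)
    · simp [hfK z hz]

theorem abs_div_gNorm_rpow {p β : ℝ} {z : GPt n} (hz : z ≠ 0) (y : ℝ) :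
    |y / gNorm z| ^ p / gNorm z ^ β = |y| ^ p * gNorm z ^ (-(p + β)) := by
  have hp := gNorm_pos hz
  rw [abs_div, abs_of_pos hp, Real.div_rpow (abs_nonneg _) hp.le, Real.rpow_neg hp.le,
    Real.rpow_add hp]
  field_simp

theorem rellich_lower_bound {p β : ℝ} (hp : 1 < p) (hβ1 : -((n + 2) * (p - 1)) < β)
    (hβ2 : β < n + 2 - p) {u : GPt n → ℝ} (hu : ContDiff ℝ (⊤ : ℕ∞) u)
    (hsu : HasCompactSupport u) :
    (((n + 2) * (p - 1) + β) / p) ^ p * ∫ z : GPt n, |u z| ^ p / gNorm z ^ (p + β)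
      ≤ ∫ z : GPt n, |radialDeriv u z + ((n : ℝ) + 2 - 1) / gNorm z * u z| ^ p / gNorm z ^ β := by
  have hp0 : 0 < p := by linarith
  set c := ((n + 2) * (p - 1) + β) / p with hcdef
  have hc : 0 < c := div_pos (by linarith) hp0
  have hcp : c * p = (n + 2) * (p - 1) + β := div_mul_cancel₀ _ hp0.ne'
  have hg := continuous_gEuler hu
  have ha : p + β < n + 2 := by linarith
  have hIu := integrable_abs_rpow_mul_gNorm_rpow hp0 ha hu.continuous hsu
    fun z hz => image_eq_zero_of_notMem_tsupport hz
  have hIg := integrable_abs_rpow_mul_gNorm_rpow hp0 ha hg hsu fun z hz => gEuler_eq_zero hz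
  have key := lintegral_le_of_dilation_average hp hc hcp hg.measurable
    (ofReal_abs_le_lintegral_gEuler hu)
  have hnn : ∀ f : GPt n → ℝ, 0 ≤ᵐ[volume] fun z => |f z| ^ p * gNorm z ^ (-(p + β)) :=
    fun f => Filter.Eventually.of_forall fun z =>
      mul_nonneg (by positivity) (Real.rpow_nonneg (gNorm_nonneg z) _)
  rw [← ofReal_integral_eq_lintegral_ofReal hIu (hnn _),
    ← ofReal_integral_eq_lintegral_ofReal hIg (hnn _), ← ENNReal.ofReal_mul (by positivity),
    ENNReal.ofReal_le_ofReal_iff (mul_nonneg (by positivity) (integral_nonneg_of_ae (hnn _)))] at key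
  have e1 : ∫ z : GPt n, |u z| ^ p / gNorm z ^ (p + β)
      = ∫ z : GPt n, |u z| ^ p * gNorm z ^ (-(p + β)) := by
    refine integral_congr_ae (Filter.Eventually.of_forall fun z => ?_)
    beta_reduce
    rw [Real.rpow_neg (gNorm_nonneg z), div_eq_mul_inv]
  have e2 : ∫ z : GPt n, |radialDeriv u z + ((n : ℝ) + 2 - 1) / gNorm z * u z| ^ p / gNorm z ^ β
      = ∫ z : GPt n, |gEuler u z| ^ p * gNorm z ^ (-(p + β)) := by
    refine integral_congr_ae (ae_ne_zero_GPt.mono fun z hz => ?_)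
    beta_reduce
    rw [radialDeriv_add (hu.differentiable (by simp)), abs_div_gNorm_rpow hz]
  rw [e1, e2, ← le_inv_mul_iff₀ (by positivity), ← Real.inv_rpow hc.le]
  exact key

theorem log_gNorm (z : GPt n) :
    Real.log (gNorm z) = Real.log ((‖z.1‖ ^ 2) ^ 2 + 4 * z.2 ^ 2) / 4 := by
  rw [← pow_mul, ← gNorm_pow_four, Real.log_pow]
  push_cast
  ring

theorem isTest_comp_log_gNorm {Φ : ℝ → ℝ} (hΦ : ContDiff ℝ (⊤ : ℕ∞) Φ) {M : ℝ}
    (h0 : ∀ s ≤ 0, Φ s = 0) (hM : ∀ s, M ≤ s → Φ s = 0) :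
    IsTest Set.univ fun z : GPt n => Φ (Real.log (gNorm z)) := by
  refine ⟨contDiff_iff_contDiffAt.2 fun z => ?_, ?_, Set.subset_univ _⟩
  · rcases eq_or_ne z 0 with rfl | hz
    · have ho : IsOpen {z : GPt n | gNorm z < 1} := isOpen_lt continuous_gNorm continuous_const
      have hmem : {z : GPt n | gNorm z < 1} ∈ nhds (0 : GPt n) :=
        ho.mem_nhds (by simp [gNorm_zero])
      refine (contDiffAt_const (c := (0 : ℝ))).congr_of_eventuallyEq ?_
      filter_upwards [hmem] with w (hw : gNorm w < 1)
      exact h0 _ (Real.log_nonpos (gNorm_nonneg w) hw.le)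
    · simp only [log_gNorm]
      refine hΦ.contDiffAt.comp z (ContDiffAt.div_const (ContDiffAt.log ?_ ?_) 4)
      · exact (((contDiff_fst.norm_sq ℝ).pow 2).add
          (contDiff_const.mul (contDiff_snd.pow 2))).contDiffAt
      · rw [← pow_mul, ← gNorm_pow_four]
        exact (pow_pos (gNorm_pos hz) 4).ne'
  · refine HasCompactSupport.intro (isCompact_gNorm_le (Real.exp M)) fun z hz => hM _ ?_
    have hz' : Real.exp M < gNorm z := not_le.1 hz
    exact (Real.le_log_iff_exp_le ((Real.exp_pos M).trans hz')).2 hz'.le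

theorem radialDeriv_comp_log_gNorm {Φ : ℝ → ℝ} (hΦ : Differentiable ℝ Φ) {z : GPt n}
    (hz : z ≠ 0) :
    radialDeriv (fun z : GPt n => Φ (Real.log (gNorm z))) z
      = deriv Φ (Real.log (gNorm z)) / gNorm z := by
  have hp := gNorm_pos hz
  have h := (hΦ (Real.log (gNorm z))).hasDerivAt.comp (gNorm z) (Real.hasDerivAt_log hp.ne')
  rw [div_eq_mul_inv, ← h.deriv, radialDeriv]
  refine Filter.EventuallyEq.deriv_eq ?_
  filter_upwards [lt_mem_nhds hp] with s hs
  have h1 := gNorm_gDil (div_pos hs hp).le z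
  rw [gDil, div_pow, div_mul_cancel₀ _ hp.ne'] at h1
  rw [h1, Function.comp_apply]

theorem integral_comp_log_gNorm {H : ℝ → ℝ} (hH : Measurable H) :
    ∫ z : GPt n, Real.exp (-(n + 2) * Real.log (gNorm z)) * H (Real.log (gNorm z))
      = (volume {z : GPt n | gNorm z ≤ 1}).toReal * (n + 2) * ∫ s, H s := by
  have hm : Measurable fun z : GPt n => Real.log (gNorm z) :=
    Real.measurable_log.comp continuous_gNorm.measurable
  have hH' : Measurable fun s => Real.exp (-(n + 2) * s) * H s := by fun_prop
  rw [← integral_map (φ := fun z : GPt n => Real.log (gNorm z)) hm.aemeasurable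
    (f := fun s => Real.exp (-(n + 2) * s) * H s) hH'.aestronglyMeasurable,
    map_log_gNorm, integral_withDensity_eq_integral_toReal_smul (by fun_prop) (by simp),
    ← integral_const_mul]
  congr 1
  funext s
  rw [ENNReal.toReal_ofReal (by positivity), smul_eq_mul, neg_mul, Real.exp_neg]
  field_simp

theorem sharp_of_bump {p β κ ε : ℝ} (hp : 1 < p) (hε : 0 < ε) {χ : ℝ → ℝ}
    (hχ : ContDiff ℝ (⊤ : ℕ∞) χ) {M : ℝ} (h0 : ∀ s ≤ 0, χ s = 0) (hM : ∀ s, M ≤ s → χ s = 0)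
    (hκ : ∀ u : GPt n → ℝ, IsTest Set.univ u →
      (∫ z : GPt n, |radialDeriv u z + ((n : ℝ) + 2 - 1) / gNorm z * u z| ^ p / gNorm z ^ β)
        ≥ κ * ∫ z : GPt n, |u z| ^ p / gNorm z ^ (p + β)) :
    κ * ∫ s, |χ s| ^ p
      ≤ ∫ s, |((n + 2) * (p - 1) + β) / p * χ s + ε * deriv χ s| ^ p := by
  have hp0 : 0 < p := by linarith
  set c := ((n + 2) * (p - 1) + β) / p with hc
  set γ := (n + 2 - p - β) / p with hγ
  have hγp : γ * p = n + 2 - p - β := div_mul_cancel₀ _ hp0.ne'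
  have hcγ : c = n + 2 - 1 - γ := by
    rw [hc, hγ]
    field_simp
    ring
  have hχd : Differentiable ℝ χ := hχ.differentiable (by simp)
  have hχ' : Continuous (deriv χ) := hχ.continuous_deriv (by simp)
  set Φ : ℝ → ℝ := fun s => Real.exp (-γ * s) * χ (ε * s) with hΦ
  have hΦs : ContDiff ℝ (⊤ : ℕ∞) Φ := by
    have := hχ.comp (contDiff_const.mul contDiff_id : ContDiff ℝ (⊤ : ℕ∞) fun s : ℝ => ε * s)
    exact (contDiff_const.mul contDiff_id).exp.mul this
  have hΦd : ∀ s, deriv Φ s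
      = Real.exp (-γ * s) * (ε * deriv χ (ε * s) - γ * χ (ε * s)) := by
    intro s
    have h1 : HasDerivAt (fun s => Real.exp (-γ * s)) (Real.exp (-γ * s) * (-γ * 1)) s :=
      ((hasDerivAt_id s).const_mul (-γ)).exp
    have h2 : HasDerivAt (fun s => χ (ε * s)) (deriv χ (ε * s) * (ε * 1)) s :=
      (hχd (ε * s)).hasDerivAt.comp s ((hasDerivAt_id s).const_mul ε)
    refine (h1.mul h2).deriv.trans ?_
    ring
  have htest : IsTest Set.univ fun z : GPt n => Φ (Real.log (gNorm z)) := by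
    refine isTest_comp_log_gNorm hΦs (M := M / ε) (fun s hs => ?_) fun s hs => ?_
    · simp only [hΦ, h0 _ (mul_nonpos_of_nonneg_of_nonpos hε.le hs), mul_zero]
    · rw [div_le_iff₀' hε] at hs
      simp only [hΦ, hM _ hs, mul_zero]
  have hexp : ∀ (z : GPt n) (y : ℝ), z ≠ 0 →
      |Real.exp (-γ * Real.log (gNorm z)) * y| ^ p * gNorm z ^ (-(p + β))
        = Real.exp (-(n + 2) * Real.log (gNorm z)) * |y| ^ p := by
    intro z y hz
    rw [abs_mul, Real.abs_exp, Real.mul_rpow (Real.exp_pos _).le (abs_nonneg _), ← Real.exp_mul,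
      Real.rpow_def_of_pos (gNorm_pos hz), mul_right_comm, ← Real.exp_add]
    congr 2
    linear_combination (-Real.log (gNorm z)) * hγp
  have e1 : ∫ z : GPt n, |Φ (Real.log (gNorm z))| ^ p / gNorm z ^ (p + β)
      = (volume {z : GPt n | gNorm z ≤ 1}).toReal * (n + 2) * (ε⁻¹ * ∫ s, |χ s| ^ p) := by
    have h := Measure.integral_comp_mul_left (fun s => |χ s| ^ p) ε
    rw [abs_of_pos (inv_pos.2 hε), smul_eq_mul] at h
    rw [← h, ← integral_comp_log_gNorm (H := fun s => |χ (ε * s)| ^ p)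
      (by have := hχ.continuous.measurable; fun_prop)]
    refine integral_congr_ae (ae_ne_zero_GPt.mono fun z hz => ?_)
    beta_reduce
    rw [← hexp z _ hz, Real.rpow_neg (gNorm_nonneg z), div_eq_mul_inv]
  have e2 : ∫ z : GPt n, |radialDeriv (fun z : GPt n => Φ (Real.log (gNorm z))) z
        + ((n : ℝ) + 2 - 1) / gNorm z * Φ (Real.log (gNorm z))| ^ p / gNorm z ^ β
      = (volume {z : GPt n | gNorm z ≤ 1}).toReal * (n + 2) *
        (ε⁻¹ * ∫ s, |c * χ s + ε * deriv χ s| ^ p) := by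
    have h := Measure.integral_comp_mul_left (fun s => |c * χ s + ε * deriv χ s| ^ p) ε
    rw [abs_of_pos (inv_pos.2 hε), smul_eq_mul] at h
    rw [← h, ← integral_comp_log_gNorm
      (H := fun s => |c * χ (ε * s) + ε * deriv χ (ε * s)| ^ p)
      (by have := hχ.continuous.measurable; have := hχ'.measurable; fun_prop)]
    refine integral_congr_ae (ae_ne_zero_GPt.mono fun z hz => ?_)
    beta_reduce
    rw [← hexp z _ hz, ← abs_div_gNorm_rpow hz,
      radialDeriv_comp_log_gNorm (hΦs.differentiable (by simp)) hz, hΦd, hcγ]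
    congr 3
    simp only [hΦ]
    ring
  have hk := hκ _ htest
  rw [e1, e2] at hk
  have hV := volume_gNorm_le_one_pos (n := n)
  have hpos : 0 < (volume {z : GPt n | gNorm z ≤ 1}).toReal * (n + 2) * ε⁻¹ := by positivity
  refine le_of_mul_le_mul_left ?_ hpos
  linarith

theorem le_rpow_of_bump {p c κ : ℝ} (hp : 0 < p) (hc : 0 < c) (χ : ContDiffBump (2 : ℝ))
    (h : ∀ ε > 0, κ * ∫ s, |χ s| ^ p ≤ ∫ s, |c * χ s + ε * deriv χ s| ^ p) :
    κ ≤ c ^ p := by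
  have hχ' : Continuous (deriv χ) := χ.contDiff.continuous_deriv le_rfl
  have hout : ∀ s ∉ tsupport χ, χ s = 0 ∧ deriv χ s = 0 := fun s hs =>
    ⟨image_eq_zero_of_notMem_tsupport hs, by
      by_contra hne
      exact hs (support_deriv_subset hne)⟩
  have hcont : ContinuousOn (fun ε : ℝ => ∫ s, |c * χ s + ε * deriv χ s| ^ p) Set.univ := by
    refine continuousOn_integral_of_compact_support (k := tsupport χ) χ.hasCompactSupport ?_ ?_
    · refine Continuous.continuousOn ?_
      refine Continuous.rpow_const ?_ fun _ => Or.inr hp.le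
      have := χ.continuous
      fun_prop
    · intro ε s _ hs
      simp [(hout s hs).1, (hout s hs).2, hp.ne']
  have hlim := (continuousOn_univ.1 hcont).tendsto 0
  have hle := ge_of_tendsto (hlim.mono_left nhdsWithin_le_nhds)
    (eventually_mem_nhdsWithin.mono fun ε (hε : ε ∈ Set.Ioi 0) => h ε hε)
  have e : ∫ s, |c * χ s + 0 * deriv χ s| ^ p = c ^ p * ∫ s, |χ s| ^ p := by
    rw [← integral_const_mul]
    congr 1
    funext s
    rw [zero_mul, add_zero, abs_mul, abs_of_pos hc, Real.mul_rpow hc.le (abs_nonneg _)]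
  rw [e] at hle
  refine le_of_mul_le_mul_right hle ?_
  refine Continuous.integral_pos_of_hasCompactSupport_nonneg_nonzero (x := 2) ?_ ?_ ?_ ?_
  · exact χ.continuous.abs.rpow_const fun _ => Or.inr hp.le
  · exact χ.hasCompactSupport.comp_left (g := fun y => |y| ^ p) (by simp [hp.ne'])
  · exact fun s => Real.rpow_nonneg (abs_nonneg _) _
  · have : χ 2 = 1 := χ.one_of_mem_closedBall (Metric.mem_closedBall_self χ.rIn_pos.le)
    simp [this]

/-- Rellich-type inequality involving the first-order radial term, with best
constant `((Q(p−1)+β)/p)^p` (Theorem 4.1 of the paper). -/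
theorem rellich_type_inequality
    (n : ℕ) (Q : ℝ) (hQ : Q = n + 2) (hQ4 : 4 ≤ Q)
    (p β : ℝ) (hp : 1 < p) (hpQ : p < Q) (hβ1 : -(Q * (p - 1)) < β) (hβ2 : β < Q - p) :
    (∀ u : GPt n → ℝ, IsTest Set.univ u →
      (∫ z : GPt n, |radialDeriv u z + (Q - 1) / gNorm z * u z| ^ p / gNorm z ^ β)
        ≥ ((Q * (p - 1) + β) / p) ^ p * ∫ z : GPt n, |u z| ^ p / gNorm z ^ (p + β))
    ∧ ∀ κ : ℝ,
        (∀ u : GPt n → ℝ, IsTest Set.univ u →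
          (∫ z : GPt n, |radialDeriv u z + (Q - 1) / gNorm z * u z| ^ p / gNorm z ^ β)
            ≥ κ * ∫ z : GPt n, |u z| ^ p / gNorm z ^ (p + β)) →
        κ ≤ ((Q * (p - 1) + β) / p) ^ p := by
  subst hQ
  have hp0 : 0 < p := by linarith
  refine ⟨fun u hu => rellich_lower_bound hp hβ1 hβ2 hu.1 hu.2.1, fun κ hκ => ?_⟩
  let χ : ContDiffBump (2 : ℝ) := ⟨1 / 2, 1, by norm_num, by norm_num⟩
  refine le_rpow_of_bump hp0 (div_pos (by linarith) hp0) χ fun ε hε => ?_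
  refine sharp_of_bump hp hε χ.contDiff (M := 3) (fun s hs => ?_) (fun s hs => ?_) hκ
  · refine χ.zero_of_le_dist ?_
    rw [Real.dist_eq]
    exact le_trans (by change (1 : ℝ) ≤ 2 - s; linarith)
      ((le_abs_self _).trans_eq (abs_sub_comm _ _))
  · refine χ.zero_of_le_dist ?_
    rw [Real.dist_eq]
    exact le_trans (by change (1 : ℝ) ≤ s - 2; linarith) (le_abs_self _)
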